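/- Let n ≥ 2 and let < and <' be conjugate left-invariant total orderings of B_n, both satisfying Property S. Then the restrictions of < and <' to the positive braid monoid B_n^+ are well-orderings of the same order type; equivalently, there is an order isomorphism between (B_n^+, <) and (B_n^+, <'). -/

import Mathlib

/-! ## The braid group and the positive braid monoid -/

/-- The braid relations on `m` generators `σ_1, …, σ_m` (indexed by `Fin m`). -/
def braidRels (m : ℕ) : Set (FreeGroup (Fin m)) :=
  {x | (∃ i j : Fin m, (i : ℕ) + 2 ≤ (j : ℕ) ∧
          x = FreeGroup.of i * FreeGroup.of j * (FreeGroup.of i)⁻¹ * (FreeGroup.of j)⁻¹) ∨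
       (∃ i j : Fin m, (j : ℕ) = (i : ℕ) + 1 ∧
          x = FreeGroup.of i * FreeGroup.of j * FreeGroup.of i *
              (FreeGroup.of j * FreeGroup.of i * FreeGroup.of j)⁻¹)}

/-- The braid group `B_n`, presented with `n-1` Artin generators. -/
abbrev BraidGroup (n : ℕ) := PresentedGroup (braidRels (n - 1))

/-- The Artin generator `σ_i` (1-based index `i`) of `B_n`. -/
def sig (n i : ℕ) : BraidGroup n :=
  if h : i - 1 < n - 1 then PresentedGroup.of (⟨i - 1, h⟩ : Fin (n - 1)) else 1

/-- The positive braid monoid `B_n^+`, the submonoid generated by the `σ_i`. -/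
def posMonoid (n : ℕ) : Submonoid (BraidGroup n) :=
  Submonoid.closure (Set.range fun i : Fin (n - 1) => (PresentedGroup.of i : BraidGroup n))

/-- Evaluation of a positive word (letters are 1-based generator indices) in `B_n`. -/
def wordEval (n : ℕ) (l : List ℕ) : BraidGroup n := (l.map (sig n)).prod

/-- Property `S` of an ordering of `B_n`:
`α σ_i β > α β > α σ_i⁻¹ β` for all `α, β` and all `1 ≤ i ≤ n-1`. -/
def PropertyS (n : ℕ) (lt : BraidGroup n → BraidGroup n → Prop) : Prop :=
  ∀ (α β : BraidGroup n) (i : ℕ), 1 ≤ i → i ≤ n - 1 →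
    lt (α * β) (α * sig n i * β) ∧ lt (α * (sig n i)⁻¹ * β) (α * β)

/-! ## The fundamental element of a sequence satisfying the braid relations -/

section BraidSequence

variable {G : Type*} [Group G] {s : ℕ → G} {m : ℕ}

/-- The product `s 0 * s 1 * ⋯ * s (k - 1)`. -/
def rangeProd (s : ℕ → G) (k : ℕ) : G := ((List.range k).map s).prod

theorem rangeProd_succ (s : ℕ → G) (k : ℕ) : rangeProd s (k + 1) = rangeProd s k * s k :=
  List.prod_range_succ s k

theorem rangeProd_succ' (s : ℕ → G) (k : ℕ) :
    rangeProd s (k + 1) = s 0 * rangeProd (fun i => s (i + 1)) k :=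
  List.prod_range_succ' s k

theorem rangeProd_mem {M : Submonoid G} (hs : ∀ i, s i ∈ M) (k : ℕ) : rangeProd s k ∈ M :=
  M.list_prod_mem (by simp [hs])

theorem commute_rangeProd (hcomm : ∀ i j, i + 2 ≤ j → j < m → s i * s j = s j * s i)
    {k i : ℕ} (hki : k + 1 ≤ i) (hi : i < m) : Commute (rangeProd s k) (s i) := by
  induction k with
  | zero => exact Commute.one_left _
  | succ k ih =>
    rw [rangeProd_succ]
    exact (ih (by omega)).mul_left (hcomm k i hki hi)

theorem semiconjBy_rangeProd (hcomm : ∀ i j, i + 2 ≤ j → j < m → s i * s j = s j * s i)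
    (hbraid : ∀ i, i + 1 < m → s i * s (i + 1) * s i = s (i + 1) * s i * s (i + 1))
    {k i : ℕ} (hik : i + 2 ≤ k) (hk : k ≤ m) :
    SemiconjBy (rangeProd s k) (s i) (s (i + 1)) := by
  induction k, hik using Nat.le_induction with
  | base =>
    have hc : rangeProd s i * s (i + 1) = s (i + 1) * rangeProd s i :=
      commute_rangeProd hcomm le_rfl (by omega)
    have hb := hbraid i (by omega)
    rw [rangeProd_succ, rangeProd_succ, SemiconjBy]
    calc rangeProd s i * s i * s (i + 1) * s i
        = rangeProd s i * (s i * s (i + 1) * s i) := by simp only [mul_assoc]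
      _ = rangeProd s i * s (i + 1) * s i * s (i + 1) := by rw [hb]; simp only [mul_assoc]
      _ = _ := by rw [hc]; simp only [mul_assoc]
  | succ k hik ih =>
    rw [rangeProd_succ]
    exact (ih (by omega)).mul_left (hcomm i k hik (by omega)).symm

theorem semiconjBy_rangeProd_pow (hcomm : ∀ i j, i + 2 ≤ j → j < m → s i * s j = s j * s i)
    (hbraid : ∀ i, i + 1 < m → s i * s (i + 1) * s i = s (i + 1) * s i * s (i + 1))
    {i : ℕ} (j : ℕ) (hij : i + j < m) :
    SemiconjBy (rangeProd s m ^ j) (s i) (s (i + j)) := by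
  induction j with
  | zero => simp
  | succ j ih =>
    rw [pow_succ']
    exact (semiconjBy_rangeProd (i := i + j) hcomm hbraid (by omega) le_rfl).mul_left
      (ih (by omega))

theorem semiconjBy_rangeProd_sq_last
    (hcomm : ∀ i j, i + 2 ≤ j → j < m → s i * s j = s j * s i)
    (hbraid : ∀ i, i + 1 < m → s i * s (i + 1) * s i = s (i + 1) * s i * s (i + 1))
    {k : ℕ} (hm : m = k + 1) : SemiconjBy (rangeProd s m ^ 2) (s k) (s 0) := by
  have shift : ∀ l, l ≤ k →
      SemiconjBy (rangeProd s m) (rangeProd s l) (rangeProd (fun i => s (i + 1)) l) := by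
    intro l hl
    induction l with
    | zero => exact SemiconjBy.one_right _
    | succ l ih =>
      rw [rangeProd_succ, rangeProd_succ]
      exact (ih (by omega)).mul_right (semiconjBy_rangeProd hcomm hbraid (by omega) le_rfl)
  have h := (shift k le_rfl).eq
  have h₁ : rangeProd s m = rangeProd s k * s k := by rw [hm, rangeProd_succ]
  have h₂ : rangeProd s m = s 0 * rangeProd (fun i => s (i + 1)) k := by rw [hm, rangeProd_succ']
  calc rangeProd s m ^ 2 * s k
      = s 0 * (rangeProd (fun i => s (i + 1)) k * rangeProd s m) * s k := by
        rw [← mul_assoc (s 0), ← h₂, sq]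
    _ = s 0 * rangeProd s m ^ 2 := by
        rw [← h, sq, mul_assoc, mul_assoc, ← h₁]

theorem commute_rangeProd_pow (hcomm : ∀ i j, i + 2 ≤ j → j < m → s i * s j = s j * s i)
    (hbraid : ∀ i, i + 1 < m → s i * s (i + 1) * s i = s (i + 1) * s i * s (i + 1))
    {i : ℕ} (hi : i < m) : Commute (rangeProd s m ^ (m + 1)) (s i) := by
  obtain ⟨j, rfl⟩ : ∃ j, m = i + j + 1 := ⟨m - i - 1, by omega⟩
  have h₁ := semiconjBy_rangeProd_pow hcomm hbraid (i := i) j (by omega)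
  have h₂ := semiconjBy_rangeProd_sq_last hcomm hbraid rfl
  have h₃ := semiconjBy_rangeProd_pow hcomm hbraid (i := 0) i (by omega)
  rw [zero_add] at h₃
  have h := h₃.mul_left (h₂.mul_left h₁)
  rw [← pow_add, ← pow_add] at h
  rwa [show i + j + 1 + 1 = i + (2 + j) by omega]

theorem rangeProd_pow_mul_inv_mem (hcomm : ∀ i j, i + 2 ≤ j → j < m → s i * s j = s j * s i)
    (hbraid : ∀ i, i + 1 < m → s i * s (i + 1) * s i = s (i + 1) * s i * s (i + 1))
    {M : Submonoid G} (hs : ∀ i, s i ∈ M) {i : ℕ} (hi : i < m) :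
    rangeProd s m ^ (m + 1) * (s i)⁻¹ ∈ M := by
  obtain ⟨j, hj⟩ : ∃ j, m = i + j + 1 := ⟨m - i - 1, by omega⟩
  have h := (semiconjBy_rangeProd_pow hcomm hbraid (i := i) j (by omega)).inv_right.eq
  have hlast : rangeProd s m * (s (i + j))⁻¹ = rangeProd s (i + j) := by
    rw [mul_inv_eq_iff_eq_mul, hj, rangeProd_succ]
  have hpow : m + 1 = (i + 1) + 1 + j := by omega
  rw [hpow, pow_add, mul_assoc, h, pow_succ, mul_assoc, ← mul_assoc _ _ (rangeProd s m ^ j), hlast]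
  exact mul_mem (pow_mem (rangeProd_mem hs m) _)
    (mul_mem (rangeProd_mem hs _) (pow_mem (rangeProd_mem hs m) _))

end BraidSequence

/-! ## Right translates of the positive braid monoid -/

theorem sig_mem_posMonoid (n i : ℕ) : sig n i ∈ posMonoid n := by
  unfold sig
  split_ifs with h
  · exact Submonoid.subset_closure ⟨_, rfl⟩
  · exact one_mem _

theorem of_eq_sig {n : ℕ} (i : Fin (n - 1)) :
    (PresentedGroup.of i : BraidGroup n) = sig n (i + 1) := by
  simp [sig]

theorem sig_comm {n i j : ℕ} (hij : i + 2 ≤ j) (hj : j < n - 1) :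
    sig n (i + 1) * sig n (j + 1) = sig n (j + 1) * sig n (i + 1) := by
  rw [← of_eq_sig ⟨i, by omega⟩, ← of_eq_sig ⟨j, hj⟩]
  have h := PresentedGroup.one_of_mem (rels := braidRels (n - 1))
    (Or.inl ⟨⟨i, by omega⟩, ⟨j, hj⟩, hij, rfl⟩)
  simp only [map_mul, map_inv] at h
  exact mul_inv_eq_iff_eq_mul.1 (mul_inv_eq_one.1 h)

theorem sig_braid {n i : ℕ} (hi : i + 1 < n - 1) :
    sig n (i + 1) * sig n (i + 1 + 1) * sig n (i + 1) =
      sig n (i + 1 + 1) * sig n (i + 1) * sig n (i + 1 + 1) := by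
  rw [← of_eq_sig ⟨i, by omega⟩, ← of_eq_sig ⟨i + 1, hi⟩]
  have h := PresentedGroup.one_of_mem (rels := braidRels (n - 1))
    (Or.inr ⟨⟨i, by omega⟩, ⟨i + 1, hi⟩, rfl, rfl⟩)
  simp only [map_mul, map_inv] at h
  exact mul_inv_eq_one.1 h

theorem exists_central_mul_of_inv_mem (n : ℕ) :
    ∃ D : BraidGroup n, (∀ f ∈ posMonoid n, Commute D f) ∧
      ∀ i : Fin (n - 1), D * (PresentedGroup.of i)⁻¹ ∈ posMonoid n := by
  have hcomm : ∀ i j, i + 2 ≤ j → j < n - 1 →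
    sig n (i + 1) * sig n (j + 1) = sig n (j + 1) * sig n (i + 1) := fun _ _ => sig_comm
  have hbraid : ∀ i, i + 1 < n - 1 → sig n (i + 1) * sig n (i + 1 + 1) * sig n (i + 1) =
    sig n (i + 1 + 1) * sig n (i + 1) * sig n (i + 1 + 1) := fun _ => sig_braid
  refine ⟨rangeProd (fun i => sig n (i + 1)) (n - 1) ^ (n - 1 + 1), fun f hf => ?_, fun i => ?_⟩
  · induction hf using Submonoid.closure_induction with
    | mem x hx =>
      obtain ⟨i, rfl⟩ := hx
      simp only [of_eq_sig]
      exact commute_rangeProd_pow (s := fun i => sig n (i + 1)) hcomm hbraid i.2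
    | one => exact Commute.one_right _
    | mul x y _ _ hx hy => exact hx.mul_right hy
  · rw [of_eq_sig]
    exact rangeProd_pow_mul_inv_mem (s := fun i => sig n (i + 1)) hcomm hbraid
      (fun i => sig_mem_posMonoid n _) i.2

theorem exists_mul_mul_mem_posMonoid {n : ℕ} (g : BraidGroup n) :
    ∃ c, ∀ f ∈ posMonoid n, c * f * g ∈ posMonoid n := by
  obtain ⟨D, hD, hDinv⟩ := exists_central_mul_of_inv_mem n
  have hg : g ∈ Subgroup.closure
      (Set.range (PresentedGroup.of : Fin (n - 1) → BraidGroup n)) := by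
    simp [PresentedGroup.closure_range_of]
  induction hg using Subgroup.closure_induction_right with
  | one => exact ⟨1, fun f hf => by simpa using hf⟩
  | mul_right x _ y hy ih =>
    obtain ⟨c, hc⟩ := ih
    refine ⟨c, fun f hf => ?_⟩
    rw [← mul_assoc]
    exact mul_mem (hc f hf) (Submonoid.subset_closure hy)
  | mul_inv_cancel x _ y hy ih =>
    obtain ⟨c, hc⟩ := ih
    obtain ⟨i, rfl⟩ := hy
    refine ⟨D * c, fun f hf => ?_⟩
    have h : D * c * f * (x * (PresentedGroup.of i)⁻¹) =
        c * f * x * (D * (PresentedGroup.of i)⁻¹) := by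
      rw [← mul_assoc (c * f * x), ← (hD _ (hc f hf)).eq]
      simp only [mul_assoc]
    rw [h]
    exact mul_mem (hc f hf) (hDinv i)

/-! ## Orderings with Property `S` on the positive braid monoid -/

section Orderings

variable {n : ℕ} {lt lt' : BraidGroup n → BraidGroup n → Prop}

theorem PropertyS.prod_eq_or_lt [IsTrans (BraidGroup n) lt]
    (hinv : ∀ a b c : BraidGroup n, lt a b → lt (c * a) (c * b)) (hS : PropertyS n lt)
    {l₁ l₂ : List (BraidGroup n)} (h : List.SublistForall₂ (· = ·) l₁ l₂)
    (hl : ∀ x ∈ l₂, x ∈ Set.range (fun i : Fin (n - 1) => (PresentedGroup.of i : BraidGroup n))) :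
    l₁.prod = l₂.prod ∨ lt l₁.prod l₂.prod := by
  have step : ∀ (i : Fin (n - 1)) (b : BraidGroup n), lt b (PresentedGroup.of i * b) := by
    intro i b
    have := (hS 1 b (i + 1) (by omega) (by omega)).1
    rwa [one_mul, one_mul, ← of_eq_sig] at this
  have cons_right : ∀ {a b : BraidGroup n} (i : Fin (n - 1)), (a = b ∨ lt a b) →
      (a = PresentedGroup.of i * b ∨ lt a (PresentedGroup.of i * b)) := by
    rintro a b i (rfl | h)
    · exact Or.inr (step i a)
    · exact Or.inr (_root_.trans h (step i b))
  induction h with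
  | @nil l =>
    induction l with
    | nil => exact Or.inl rfl
    | cons a l ih =>
      rw [List.forall_mem_cons] at hl
      obtain ⟨⟨i, rfl⟩, hl⟩ := hl
      rw [List.prod_cons]
      exact cons_right i (ih hl)
  | cons hab _ ih =>
    subst hab
    rw [List.forall_mem_cons] at hl
    rw [List.prod_cons, List.prod_cons]
    exact (ih hl.2).imp (congrArg _) (hinv _ _ _)
  | cons_right _ ih =>
    rw [List.forall_mem_cons] at hl
    obtain ⟨⟨i, rfl⟩, hl⟩ := hl
    rw [List.prod_cons]
    exact cons_right i (ih hl)

theorem PropertyS.wellFounded_posMonoid [IsStrictTotalOrder (BraidGroup n) lt]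
    (hinv : ∀ a b c : BraidGroup n, lt a b → lt (c * a) (c * b)) (hS : PropertyS n lt) :
    WellFounded (Subrel lt (· ∈ posMonoid n)) := by
  rw [RelEmbedding.wellFounded_iff_isEmpty]
  refine ⟨fun f => ?_⟩
  choose w hw hprod using fun k => Submonoid.exists_list_of_mem_closure (f k).2
  have hpwo := (Set.finite_range
    (fun i : Fin (n - 1) => (PresentedGroup.of i : BraidGroup n))).partiallyWellOrderedOn
      (r := (· = ·))
  obtain ⟨i, j, hij, h⟩ :=
    (Set.PartiallyWellOrderedOn.partiallyWellOrderedOn_sublistForall₂ _ hpwo).exists_lt hw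
  have hlt : lt (f j) (f i) := f.map_rel_iff.2 hij
  have hle := hS.prod_eq_or_lt hinv h (hw j)
  rw [hprod, hprod] at hle
  obtain heq | hgt := hle
  · rw [heq] at hlt
    exact irrefl _ hlt
  · exact asymm hlt hgt

theorem PropertyS.exists_least [IsStrictTotalOrder (BraidGroup n) lt]
    (hinv : ∀ a b c : BraidGroup n, lt a b → lt (c * a) (c * b)) (hS : PropertyS n lt)
    {S : Set (BraidGroup n)} (hpos : S ⊆ (posMonoid n : Set (BraidGroup n))) (hne : S.Nonempty) :
    ∃ a ∈ S, ∀ b ∈ S, a = b ∨ lt a b := by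
  obtain ⟨x, hx⟩ := hne
  obtain ⟨a, ha, hmin⟩ := (hS.wellFounded_posMonoid hinv).has_min (Subtype.val ⁻¹' S)
    ⟨⟨x, hpos hx⟩, hx⟩
  refine ⟨a, ha, fun b hb => ?_⟩
  rcases trichotomous_of lt a.1 b with h | h | h
  · exact Or.inr h
  · exact Or.inl h
  · exact absurd h (hmin ⟨b, hpos hb⟩ hb)

theorem nonempty_relEmbedding_posMonoid
    (hinv' : ∀ a b c : BraidGroup n, lt' a b → lt' (c * a) (c * b)) {g : BraidGroup n}
    (hg : ∀ f h : BraidGroup n, lt f h ↔ lt' (f * g) (h * g)) :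
    Nonempty (Subrel lt (· ∈ posMonoid n) ↪r Subrel lt' (· ∈ posMonoid n)) := by
  obtain ⟨c, hc⟩ := exists_mul_mul_mem_posMonoid g
  refine ⟨⟨⟨fun f => ⟨c * f.1 * g, hc f.1 f.2⟩, fun a b hab => ?_⟩, fun {a b} => ?_⟩⟩
  · exact Subtype.ext (mul_left_cancel (mul_right_cancel (congrArg Subtype.val hab)))
  · change lt' (c * a.1 * g) (c * b.1 * g) ↔ lt a.1 b.1
    rw [hg, mul_assoc, mul_assoc]
    exact ⟨fun h => by simpa using hinv' _ _ c⁻¹ h, hinv' _ _ c⟩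

end Orderings

/-- Conjugate left-invariant total orderings of `B_n` with Property `S`
restrict to well-orderings of the positive braid monoid of the same order type:
both restrictions are well-orderings, and there is an order isomorphism between
`(B_n^+, <)` and `(B_n^+, <')`. -/
theorem conjugate_orderings_same_order_type_on_positive_monoid
    (n : ℕ) (hn : 2 ≤ n) (lt lt' : BraidGroup n → BraidGroup n → Prop)
    (hto : IsStrictTotalOrder (BraidGroup n) lt)
    (hto' : IsStrictTotalOrder (BraidGroup n) lt')
    (hinv : ∀ a b c : BraidGroup n, lt a b → lt (c * a) (c * b))
    (hinv' : ∀ a b c : BraidGroup n, lt' a b → lt' (c * a) (c * b))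
    (hS : PropertyS n lt) (hS' : PropertyS n lt')
    (hconj : ∃ g : BraidGroup n, ∀ f h : BraidGroup n, lt f h ↔ lt' (f * g) (h * g)) :
    (∀ S : Set (BraidGroup n), S ⊆ (posMonoid n : Set (BraidGroup n)) → S.Nonempty →
        ∃ a ∈ S, ∀ b ∈ S, a = b ∨ lt a b) ∧
    (∀ S : Set (BraidGroup n), S ⊆ (posMonoid n : Set (BraidGroup n)) → S.Nonempty →
        ∃ a ∈ S, ∀ b ∈ S, a = b ∨ lt' a b) ∧
    ∃ e : {x : BraidGroup n // x ∈ posMonoid n} ≃ {x : BraidGroup n // x ∈ posMonoid n},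
      ∀ a b : {x : BraidGroup n // x ∈ posMonoid n},
        lt a.1 b.1 ↔ lt' (e a).1 (e b).1 := by
  obtain ⟨g, hg⟩ := hconj
  have hg' : ∀ f h : BraidGroup n, lt' f h ↔ lt (f * g⁻¹) (h * g⁻¹) := fun f h => by
    simp [hg]
  refine ⟨fun S => hS.exists_least hinv, fun S => hS'.exists_least hinv', ?_⟩
  have : IsWellFounded _ (Subrel lt (· ∈ posMonoid n)) := ⟨hS.wellFounded_posMonoid hinv⟩
  have : IsWellFounded _ (Subrel lt' (· ∈ posMonoid n)) := ⟨hS'.wellFounded_posMonoid hinv'⟩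
  have : IsWellOrder _ (Subrel lt (· ∈ posMonoid n)) := {}
  have : IsWellOrder _ (Subrel lt' (· ∈ posMonoid n)) := {}
  obtain ⟨e⟩ := Ordinal.type_eq.1 (le_antisymm
    (Ordinal.type_le_iff'.2 (nonempty_relEmbedding_posMonoid hinv' hg))
    (Ordinal.type_le_iff'.2 (nonempty_relEmbedding_posMonoid hinv hg')))
  exact ⟨e.toEquiv, fun a b => e.map_rel_iff.symm⟩
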